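/- arXiv:1308.3749 — 13 statements merged into one kernel-verified Lean document; each statement's English description precedes it below -/
import Mathlib

section
/- There do not exist functions φ_i (for i < ω) mapping the family of meager subsets of ℝ into the family of closed nowhere dense subsets of ℝ such that A ⊆ ⋃_{i<ω} φ_i(A) for every meager set A ⊆ ℝ, and φ_i(A + r) = φ_i(A) + r for every meager set A ⊆ ℝ, every real number r, and every i < ω. -/
/-- There do not exist functions `φ i` (for `i < ω`) mapping the family of meager subsets
of `ℝ` into the family of closed nowhere dense subsets of `ℝ` such that
`A ⊆ ⋃ i, φ i A` for every meager `A`, and `φ i (A + r) = φ i A + r` for every meager `A`,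
real `r` and every `i`. -/
theorem no_translation_invariant_closed_nwd_cover :
    ¬ ∃ φ : ℕ → Set ℝ → Set ℝ,
      (∀ (i : ℕ) (A : Set ℝ), IsMeagre A → IsClosed (φ i A) ∧ IsNowhereDense (φ i A)) ∧
      (∀ A : Set ℝ, IsMeagre A → A ⊆ ⋃ i : ℕ, φ i A) ∧
      (∀ (i : ℕ) (A : Set ℝ) (r : ℝ), IsMeagre A →
        φ i ((· + r) '' A) = (· + r) '' φ i A) := by
  rintro ⟨φ, hnwd, hcover, htrans⟩
  set Q : Set ℝ := Set.range ((↑) : ℚ → ℝ)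
  have hQ : IsMeagre Q := by
    rw [show Q = ⋃ q : ℚ, {(q : ℝ)} from (Set.iUnion_singleton_eq_range _).symm]
    exact isMeagre_iUnion fun q => IsNowhereDense.isMeagre (by simp [IsNowhereDense])
  have hinv (q : ℚ) : (· + (q : ℝ)) '' Q = Q := by
    ext x
    constructor
    · rintro ⟨_, ⟨p, rfl⟩, rfl⟩
      exact ⟨p + q, by push_cast; rfl⟩
    · rintro ⟨p, rfl⟩
      exact ⟨_, ⟨p - q, rfl⟩, by push_cast; ring⟩
  obtain ⟨i, hi⟩ := Set.mem_iUnion.1 (hcover Q hQ ⟨0, rfl⟩)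
  have hsub : Q ⊆ φ i Q := by
    rintro _ ⟨q, rfl⟩
    have h := htrans i Q q hQ
    rw [hinv q] at h
    rw [h]
    exact ⟨_, hi, by simp⟩
  have hdense : Dense (φ i Q) := Rat.denseRange_cast.mono hsub
  have h := (hnwd i Q hQ).2
  rw [IsNowhereDense, hdense.closure_eq, interior_univ] at h
  exact Set.univ_nonempty.ne_empty h
end

section
/- If A, B ⊆ ℝⁿ are both of the second category (i.e., non-meager) and A has the Baire property, then the set A + B = {a + b : a ∈ A, b ∈ B} has an interior point. -/
open Pointwise

/-- A non-meager subset of a second-countable space is non-meager in every nonempty open subset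
of some nonempty open set. -/
theorem exists_isOpen_forall_not_isMeagre_inter {X : Type*} [TopologicalSpace X]
    [SecondCountableTopology X] {B : Set X} (hB : ¬ IsMeagre B) :
    ∃ W : Set X, IsOpen W ∧ W.Nonempty ∧
      ∀ V ⊆ W, IsOpen V → V.Nonempty → ¬ IsMeagre (V ∩ B) := by
  let S : Set (Set X) := {V ∈ TopologicalSpace.countableBasis X | IsMeagre (V ∩ B)}
  have hS : S.Countable := (TopologicalSpace.countable_countableBasis X).mono fun _ h => h.1
  have hSo : IsOpen (⋃ V ∈ S, V) :=
    isOpen_biUnion fun V hV => TopologicalSpace.isOpen_of_mem_countableBasis hV.1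
  have hSB : IsMeagre (⋃ V ∈ S, V ∩ B) := isMeagre_biUnion hS fun V hV => hV.2
  refine ⟨interior (⋃ V ∈ S, V)ᶜ, isOpen_interior, ?_, ?_⟩
  · by_contra h
    have hC : IsMeagre (⋃ V ∈ S, V)ᶜ :=
      (hSo.isClosed_compl.isNowhereDense_iff.2 (Set.not_nonempty_iff_eq_empty.1 h)).isMeagre
    refine hB ((hSB.union hC).mono fun x hx => ?_)
    by_cases hxS : x ∈ ⋃ V ∈ S, V
    · obtain ⟨V, hV, hxV⟩ := Set.mem_iUnion₂.1 hxS
      exact Or.inl (Set.mem_iUnion₂.2 ⟨V, hV, hxV, hx⟩)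
    · exact Or.inr hxS
  · rintro V hVW hV ⟨x, hx⟩ hm
    obtain ⟨O, hO, hxO, hOV⟩ :=
      (TopologicalSpace.isBasis_countableBasis X).exists_subset_of_mem_open hx hV
    exact interior_subset (hVW hx) (Set.mem_iUnion₂.2
      ⟨O, ⟨hO, hm.mono (Set.inter_subset_inter_left B hOV)⟩, hxO⟩)

/-- If `U` is open and `U \ A` is meager, and `B` is non-meager in every nonempty open subset of
the open set `W`, then `U + W ⊆ A + B`. -/
theorem add_subset_add_of_isMeagre_diff {G : Type*} [AddCommGroup G] [TopologicalSpace G]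
    [IsTopologicalAddGroup G] {A B U W : Set G} (hU : IsOpen U) (hUA : IsMeagre (U \ A))
    (hW : IsOpen W) (hWB : ∀ V ⊆ W, IsOpen V → V.Nonempty → ¬ IsMeagre (V ∩ B)) :
    U + W ⊆ A + B := by
  rintro _ ⟨u, hu, w, hw, rfl⟩
  let f := Homeomorph.subLeft (u + w)
  have hm : IsMeagre (f ⁻¹' (U \ A)) := hUA.preimage_of_isOpenMap f.continuous f.isOpenMap
  have hV := hWB (f ⁻¹' U ∩ W) Set.inter_subset_right ((hU.preimage f.continuous).inter hW)
    ⟨w, by simpa [f] using hu, hw⟩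
  obtain ⟨b, ⟨⟨hbU, -⟩, hbB⟩, hb⟩ := Set.not_subset.1 fun h => hV (hm.mono h)
  have hbA : u + w - b ∈ A := by
    by_contra h
    exact hb ⟨hbU, h⟩
  exact ⟨u + w - b, hbA, b, hbB, sub_add_cancel _ _⟩

/-- If `A, B ⊆ ℝⁿ` are both of the second category (non-meager) and `A` has the Baire
property (differs from an open set by a meager set), then `A + B` has an interior point. -/
theorem second_category_add_has_interior_point (n : ℕ) (hn : 1 ≤ n)
    (A B : Set (Fin n → ℝ)) (hA : ¬ IsMeagre A) (hB : ¬ IsMeagre B)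
    (hBP : ∃ U : Set (Fin n → ℝ), IsOpen U ∧ IsMeagre ((A \ U) ∪ (U \ A))) :
    (interior (A + B)).Nonempty := by
  obtain ⟨U, hU, hUA⟩ := hBP
  obtain ⟨W, hW, hWne, hWB⟩ := exists_isOpen_forall_not_isMeagre_inter hB
  have hUne : U.Nonempty := by
    by_contra h
    rw [Set.not_nonempty_iff_eq_empty.1 h] at hUA
    exact hA (by simpa using hUA)
  exact (hUne.add hWne).mono (interior_maximal
    (add_subset_add_of_isMeagre_diff hU (hUA.mono Set.subset_union_right) hW hWB) hU.add_right)
end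

section
/- If A, B ⊆ ℝⁿ are both not Lebesgue null (i.e., neither is contained in a Borel set of Lebesgue measure zero) and A is Lebesgue measurable, then the set A + B = {a + b : a ∈ A, b ∈ B} has an interior point. -/
open Pointwise MeasureTheory

section AddSets

open Filter Topology

variable {G : Type*} [AddCommGroup G] [TopologicalSpace G] [IsTopologicalAddGroup G]
  [MeasurableSpace G] [BorelSpace G]

/-- A set of positive outer measure meets some translate of a measurable set of positive measure
in a set of positive outer measure. -/
theorem exists_measure_inter_vadd_ne_zero [MeasurableAdd₂ G] {μ : Measure G} [SFinite μ]
    [μ.IsAddLeftInvariant] {s : Set G} (hs : MeasurableSet s) (hs₀ : μ s ≠ 0) {t : Set G}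
    (ht₀ : μ t ≠ 0) : ∃ g : G, μ (t ∩ (g +ᵥ s)) ≠ 0 := by
  by_contra! h
  set t' := toMeasurable μ t
  have ht' : MeasurableSet t' := measurableSet_toMeasurable μ t
  have hmeas : MeasurableSet {p : G × G | ¬ (p.2 ∈ t' ∧ -p.1 + p.2 ∈ s)} :=
    ((measurable_snd ht').inter ((measurable_fst.neg.add measurable_snd) hs)).compl
  have h_left : ∀ᵐ x ∂μ, ∀ᵐ y ∂μ, ¬ (y ∈ t' ∧ -x + y ∈ s) := by
    refine .of_forall fun x ↦ ?_
    have hx := h x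
    rw [← Measure.measure_toMeasurable_inter_of_sFinite (hs.const_vadd x)] at hx
    rw [ae_iff]
    convert hx using 2
    ext y
    simp [Set.mem_vadd_set_iff_neg_vadd_mem, t']
  rw [Measure.ae_ae_comm hmeas] at h_left
  refine ht₀ ?_
  rw [← measure_toMeasurable t, measure_eq_zero_iff_ae_notMem]
  filter_upwards [h_left] with y hy hyt
  have hy' : μ ((fun x ↦ y - x) ⁻¹' s) = 0 := by
    rw [ae_iff] at hy
    convert hy using 2
    ext x
    simp [t', hyt, sub_eq_neg_add]
  have hmap := absolutelyContinuous_map_sub_left μ y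
  refine hs₀ (hmap ?_)
  rwa [Measure.map_apply (by fun_prop) hs]

/-- If `s` is compact, then having a positive-measure intersection with `g +ᵥ s` is an open
condition on `g`. -/
theorem eventually_measure_inter_vadd_ne_zero [LocallyCompactSpace G] [T2Space G] {μ : Measure G}
    [IsFiniteMeasureOnCompacts μ] [μ.InnerRegularCompactLTTop] [μ.IsAddLeftInvariant]
    {s t : Set G} (hs : IsCompact s)
    {g : G} (hg : μ (t ∩ (g +ᵥ s)) ≠ 0) : ∀ᶠ h in 𝓝 g, μ (t ∩ (h +ᵥ s)) ≠ 0 := by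
  have hlim : Tendsto (fun h ↦ μ (((-h + g) +ᵥ s) \ s)) (𝓝 g) (𝓝 0) := by
    refine (tendsto_measure_vadd_sdiff_isCompact_isClosed (μ := μ) hs hs.isClosed).comp ?_
    have : Continuous fun h : G ↦ -h + g := by fun_prop
    simpa using this.tendsto g
  filter_upwards [hlim.eventually (gt_mem_nhds (pos_iff_ne_zero.2 hg))] with h hh h₀
  refine hh.not_ge ?_
  calc μ (t ∩ (g +ᵥ s)) ≤ μ ((t ∩ (h +ᵥ s)) ∪ ((g +ᵥ s) \ (h +ᵥ s))) :=
        measure_mono fun x hx ↦ by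
          by_cases hxh : x ∈ h +ᵥ s
          · exact .inl ⟨hx.1, hxh⟩
          · exact .inr ⟨hx.2, hxh⟩
    _ ≤ μ (t ∩ (h +ᵥ s)) + μ ((g +ᵥ s) \ (h +ᵥ s)) := measure_union_le _ _
    _ = μ ((g +ᵥ s) \ (h +ᵥ s)) := by rw [h₀, zero_add]
    _ = μ (((-h + g) +ᵥ s) \ s) := by
        rw [← measure_vadd μ (-h) ((g +ᵥ s) \ (h +ᵥ s)), Set.vadd_set_sdiff, vadd_vadd, vadd_vadd,
          neg_add_cancel, zero_vadd]

/-- The sum of a measurable set of positive Haar measure and an arbitrary set of positive outer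
Haar measure has nonempty interior. -/
theorem interior_add_nonempty_of_measure_ne_zero [LocallyCompactSpace G] [T2Space G]
    [SecondCountableTopology G] {μ : Measure G} [μ.IsAddHaarMeasure] [μ.InnerRegular]
    {s t : Set G} (hs : NullMeasurableSet s μ) (hs₀ : μ s ≠ 0) (ht₀ : μ t ≠ 0) :
    (interior (s + t)).Nonempty := by
  obtain ⟨s', hs's, hs', hae⟩ := hs.exists_measurable_subset_ae_eq
  obtain ⟨k, hks, hk, hk₀⟩ := hs'.exists_lt_isCompact (μ := μ) (r := 0)
    (by rw [measure_congr hae]; exact pos_iff_ne_zero.2 hs₀)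
  obtain ⟨g, hg⟩ := exists_measure_inter_vadd_ne_zero (μ := μ) hk.neg.measurableSet
    (by rw [Measure.measure_neg]; exact hk₀.ne') ht₀
  refine ⟨g, mem_interior_iff_mem_nhds.2 ?_⟩
  filter_upwards [eventually_measure_inter_vadd_ne_zero hk.neg hg] with h hh
  obtain ⟨y, hyt, hy⟩ := nonempty_of_measure_ne_zero hh
  rw [Set.mem_vadd_set_iff_neg_vadd_mem, Set.mem_neg, vadd_eq_add, neg_add_rev, neg_neg] at hy
  exact ⟨-y + h, hs's (hks hy), y, hyt, by simp⟩

end AddSets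

/-- If `A, B ⊆ ℝⁿ` are both not Lebesgue null and `A` is Lebesgue measurable,
then `A + B` has an interior point. -/
theorem nonnull_add_has_interior_point (n : ℕ) (hn : 1 ≤ n)
    (A B : Set (Fin n → ℝ)) (hA : volume A ≠ 0) (hB : volume B ≠ 0)
    (hAmeas : NullMeasurableSet A volume) :
    (interior (A + B)).Nonempty :=
  interior_add_nonempty_of_measure_ne_zero hAmeas hA hB
end

section
/- If the additive group ℝⁿ has a subgroup G that is Lebesgue null and non-meager, then there is no translation invariant Borel hull operation on 𝒩 with respect to 𝒩. -/
open MeasureTheory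

/-- A nonmeager subgroup of a connected topological group is dense. -/
theorem dense_addSubgroup_of_not_isMeagre {X : Type*} [AddGroup X] [TopologicalSpace X]
    [IsTopologicalAddGroup X] [ConnectedSpace X] (G : AddSubgroup X)
    (hG : ¬ IsMeagre (G : Set X)) : Dense (G : Set X) := by
  have hne : (interior (closure (G : Set X))).Nonempty := by
    rw [Set.nonempty_iff_ne_empty]
    intro h
    exact hG (IsNowhereDense.isMeagre h)
  obtain ⟨x, hx⟩ := hne
  have hopen : IsOpen (G.topologicalClosure : Set X) :=
    AddSubgroup.isOpen_of_mem_nhds _ (mem_interior_iff_mem_nhds.1 hx)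
  have hclopen : IsClopen (closure (G : Set X)) := ⟨isClosed_closure, hopen⟩
  exact dense_iff_closure_eq.2 (hclopen.eq_univ ⟨0, subset_closure G.zero_mem⟩)

/-- A nonmeager Baire measurable set differs from some nonempty open set by a meager set. -/
theorem BaireMeasurableSet.exists_isOpen_nonempty {X : Type*} [TopologicalSpace X] {s : Set X}
    (hs : BaireMeasurableSet s) (hm : ¬ IsMeagre s) :
    ∃ u : Set X, IsOpen u ∧ u.Nonempty ∧ s =ᶠ[residual X] u := by
  obtain ⟨u, hu, hsu⟩ := hs.residualEq_isOpen
  refine ⟨u, hu, ?_, hsu⟩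
  rw [Set.nonempty_iff_ne_empty]
  rintro rfl
  refine hm ?_
  filter_upwards [hsu.mem_iff] with x hx
  simpa using hx

/-- Two nonmeager Baire measurable sets, one of which is invariant under a dense set of
translations, intersect. -/
theorem BaireMeasurableSet.inter_nonempty_of_dense_translations {X : Type*} [AddGroup X]
    [TopologicalSpace X] [IsTopologicalAddGroup X] [BaireSpace X] {G C D : Set X} (hG : Dense G)
    (hC : BaireMeasurableSet C) (hD : BaireMeasurableSet D)
    (hinv : ∀ g ∈ G, (· + g) ⁻¹' C = C) (hCm : ¬ IsMeagre C) (hDm : ¬ IsMeagre D) :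
    (C ∩ D).Nonempty := by
  obtain ⟨U, hU, ⟨a, ha⟩, hCU⟩ := hC.exists_isOpen_nonempty hCm
  obtain ⟨V, hV, ⟨b, hb⟩, hDV⟩ := hD.exists_isOpen_nonempty hDm
  obtain ⟨g, hgU, hg⟩ := hG.inter_open_nonempty ((b + ·) ⁻¹' U)
    (hU.preimage (continuous_const_add b)) ⟨-b + a, by simpa using ha⟩
  have hopen : IsOpen ((· + g) ⁻¹' U ∩ V) := (hU.preimage (continuous_add_const g)).inter hV
  have hCU' : (· + g) ⁻¹' C =ᶠ[residual X] (· + g) ⁻¹' U :=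
    hCU.comp_tendsto 
      (tendsto_residual_of_isOpenMap (continuous_add_const g) (isOpenMap_add_right g))
  rw [hinv g hg] at hCU'
  by_contra hne
  rw [Set.not_nonempty_iff_eq_empty] at hne
  refine not_isMeagre_of_isOpen hopen ⟨b, hgU, hb⟩ ?_
  filter_upwards [(hCU'.inter hDV).mem_iff] with x hx
  rw [hne] at hx
  simpa using hx

/-- A nonempty set invariant under translation by a nonmeager subgroup is nonmeager. -/
theorem not_isMeagre_of_translation_invariant {X : Type*} [AddGroup X] [TopologicalSpace X]
    [IsTopologicalAddGroup X] {G : AddSubgroup X} (hG : ¬ IsMeagre (G : Set X)) {s : Set X}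
    (hs : s.Nonempty) (hinv : ∀ g ∈ G, (· + g) ⁻¹' s = s) : ¬ IsMeagre s := by
  obtain ⟨x, hx⟩ := hs
  intro hm
  refine hG ((hm.preimage_of_isOpenMap (continuous_const_add x) (isOpenMap_add_left x)).mono ?_)
  intro g hg
  change x ∈ (· + g) ⁻¹' s
  rwa [hinv g hg]

/-- If the additive group `ℝⁿ` has a subgroup `G` that is Lebesgue null and non-meager,
then there is no translation invariant Borel hull operation on `𝒩` with respect to `𝒩`. -/
theorem no_translation_invariant_hull_on_null (n : ℕ) (hn : 1 ≤ n)
    (G : AddSubgroup (Fin n → ℝ)) (hGnull : volume (G : Set (Fin n → ℝ)) = 0)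
    (hGnonmeager : ¬ IsMeagre (G : Set (Fin n → ℝ))) :
    ¬ ∃ ψ : Set (Fin n → ℝ) → Set (Fin n → ℝ),
      (∀ A : Set (Fin n → ℝ), volume A = 0 →
        MeasurableSet (ψ A) ∧ A ⊆ ψ A ∧ volume (ψ A \ A) = 0) ∧
      (∀ A : Set (Fin n → ℝ), volume A = 0 → ∀ x : Fin n → ℝ,
        ψ ((· + x) '' A) = (· + x) '' ψ A) := by
  rintro ⟨ψ, hψ, htrans⟩
  obtain ⟨hmeas, hsub, hdiff⟩ := hψ G hGnull
  have hnull : volume (ψ G) = 0 := by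
    rw [← Set.sdiff_union_of_subset hsub]
    exact measure_union_null hdiff hGnull
  have hinv : ∀ g ∈ G, (· + g) ⁻¹' ψ G = ψ G := by
    intro g hg
    have hG : (· + g) '' (G : Set (Fin n → ℝ)) = G := by
      ext x
      simp [G.add_mem_cancel_right (G.neg_mem hg)]
    have h := htrans G hGnull g
    rw [hG] at h
    conv_lhs => rw [h]
    exact Set.preimage_image_eq _ (add_left_injective g)
  have hinv' : ∀ g ∈ G, (· + g) ⁻¹' (ψ G)ᶜ = (ψ G)ᶜ := by
    intro g hg
    rw [Set.preimage_compl, hinv g hg]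
  have hne : ((ψ G)ᶜ).Nonempty := by
    rw [Set.nonempty_compl]
    intro h
    rw [h] at hnull
    exact NeZero.ne (volume : Measure (Fin n → ℝ)) (Measure.measure_univ_eq_zero.1 hnull)
  obtain ⟨x, hx, hx'⟩ := BaireMeasurableSet.inter_nonempty_of_dense_translations
    (dense_addSubgroup_of_not_isMeagre G hGnonmeager) hmeas.baireMeasurableSet
    hmeas.compl.baireMeasurableSet
    hinv (fun h => hGnonmeager (h.mono hsub))
    (not_isMeagre_of_translation_invariant hGnonmeager hne hinv')
  exact hx' hx
end

section
/- If the additive group ℝⁿ has a subgroup H that is meager and not Lebesgue null, then there is no translation invariant Borel hull operation on ℳ with respect to ℳ. -/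
open MeasureTheory

open Set Filter Topology Pointwise in
/-- A subgroup of positive outer Haar measure in a connected group is dense. -/
theorem AddSubgroup.dense_of_addHaar_ne_zero {G : Type*} [AddCommGroup G] [TopologicalSpace G]
    [IsTopologicalAddGroup G] [MeasurableSpace G] [BorelSpace G] [LocallyCompactSpace G]
    [PreconnectedSpace G] (μ : Measure G) [μ.IsAddHaarMeasure] [μ.InnerRegular]
    (H : AddSubgroup G) (hH : μ (H : Set G) ≠ 0) : Dense (H : Set G) := by
  set K := H.topologicalClosure with hK
  have hpos : 0 < μ (K : Set G) :=
    (pos_iff_ne_zero.2 hH).trans_le (measure_mono H.le_topologicalClosure)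
  have hclosed : IsClosed (K : Set G) := H.isClosed_topologicalClosure
  have hnhds : (K : Set G) ∈ 𝓝 (0 : G) := by
    refine mem_of_superset
      (Measure.sub_mem_nhds_zero_of_addHaar_pos μ _ hclosed.measurableSet hpos) ?_
    rintro _ ⟨a, ha, b, hb, rfl⟩
    exact K.sub_mem ha hb
  have huniv : (K : Set G) = univ :=
    IsClopen.eq_univ ⟨hclosed, K.isOpen_of_mem_nhds hnhds⟩ ⟨0, K.zero_mem⟩
  rwa [hK, H.topologicalClosure_coe, ← dense_iff_closure_eq] at huniv

open Set in
/-- Two measurable sets of positive measure have a translate meeting in positive measure. -/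
theorem exists_measure_preimage_sub_inter_ne_zero {G : Type*} [AddCommGroup G]
    [MeasurableSpace G] [MeasurableAdd₂ G] [MeasurableNeg G] (μ : Measure G) [SFinite μ]
    [μ.IsAddLeftInvariant] [μ.IsNegInvariant] {B C : Set G} (hB : MeasurableSet B)
    (hC : MeasurableSet C) (hB0 : μ B ≠ 0) (hC0 : μ C ≠ 0) :
    ∃ g, μ ((· - g) ⁻¹' B ∩ C) ≠ 0 := by
  by_contra! h
  let S : Set (G × G) := {p | p.1 - p.2 ∈ B ∧ p.1 ∈ C}
  have hS : MeasurableSet S :=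
    ((measurable_fst.sub measurable_snd) hB).inter (measurable_fst hC)
  have hswap : (μ.prod μ) (Prod.swap ⁻¹' S) = 0 :=
    (Measure.measure_prod_null (measurable_swap hS)).2 (.of_forall h)
  have hnull : (μ.prod μ) S = 0 := by
    rwa [← Measure.map_apply measurable_swap hS, Measure.prod_swap] at hswap
  have hae := (Measure.measure_prod_null hS).1 hnull
  refine hC0 (measure_mono_null (fun x hx ↦ ?_) (ae_iff.1 hae))
  have hsec : Prod.mk x ⁻¹' S = (x - ·) ⁻¹' B := by
    ext g
    simp [S, hx]
  have : μ ((x - ·) ⁻¹' B) = μ B :=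
    (Measure.measurePreserving_sub_left μ x).measure_preimage hB.nullMeasurableSet
  simpa [hsec, this] using hB0

open Set Filter Topology Pointwise in
/-- A Borel set of positive Haar measure stable under a dense subgroup is conull. -/
theorem measure_compl_eq_zero_of_dense_add_mem {G : Type*} [AddCommGroup G] [TopologicalSpace G]
    [IsTopologicalAddGroup G] [MeasurableSpace G] [BorelSpace G] [LocallyCompactSpace G]
    [SecondCountableTopology G] (μ : Measure G) [μ.IsAddHaarMeasure]
    [μ.InnerRegular] [SFinite μ] [μ.IsNegInvariant] {D B : Set G} (hD : Dense D)
    (hB : MeasurableSet B) (hDB : ∀ d ∈ D, ∀ b ∈ B, b + d ∈ B) (hB0 : μ B ≠ 0) :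
    μ Bᶜ = 0 := by
  by_contra hC0
  obtain ⟨g, hg⟩ := exists_measure_preimage_sub_inter_ne_zero μ hB hB.compl hB0 hC0
  have hE : MeasurableSet ((· - g) ⁻¹' B ∩ Bᶜ) := (measurable_id.sub_const g hB).inter hB.compl
  have hnhds := Measure.sub_mem_nhds_zero_of_addHaar_pos μ _ hE (pos_iff_ne_zero.2 hg)
  have hg : (fun d ↦ d - g) ⁻¹' (((· - g) ⁻¹' B ∩ Bᶜ) - ((· - g) ⁻¹' B ∩ Bᶜ)) ∈ 𝓝 g :=
    (continuous_id.sub continuous_const).continuousAt.preimage_mem_nhds (by simpa using hnhds)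
  obtain ⟨d, hd, x, hx, y, hy, hxy⟩ := hD.inter_nhds_nonempty hg
  have : x = (y - g) + d := by
    simp only at hxy
    rw [sub_add_eq_add_sub, add_sub_assoc, ← hxy]
    abel
  exact hx.2 (this ▸ hDB d hd _ hy.1)



/-- If the additive group `ℝⁿ` has a subgroup `H` that is meager and not Lebesgue null,
then there is no translation invariant Borel hull operation on `ℳ` with respect to `ℳ`. -/
theorem no_translation_invariant_hull_on_meager (n : ℕ) (hn : 1 ≤ n)
    (H : AddSubgroup (Fin n → ℝ)) (hHmeager : IsMeagre (H : Set (Fin n → ℝ)))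
    (hHnotnull : volume (H : Set (Fin n → ℝ)) ≠ 0) :
    ¬ ∃ ψ : Set (Fin n → ℝ) → Set (Fin n → ℝ),
      (∀ A : Set (Fin n → ℝ), IsMeagre A →
        MeasurableSet (ψ A) ∧ A ⊆ ψ A ∧ IsMeagre (ψ A \ A)) ∧
      (∀ A : Set (Fin n → ℝ), IsMeagre A → ∀ x : Fin n → ℝ,
        ψ ((· + x) '' A) = (· + x) '' ψ A) := by

  rintro ⟨ψ, hψ, hinv⟩
  obtain ⟨hmeas, hsub, hdiff⟩ := hψ H hHmeager
  set B := ψ H with hB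
  have hBmeager : IsMeagre B := by
    rw [← Set.sdiff_union_of_subset hsub]
    exact hdiff.union hHmeager
  have hstab : ∀ h ∈ H, (· + h) '' B = B := fun h hh ↦ by
    have hHh : (· + h) '' (H : Set (Fin n → ℝ)) = H := by
      ext x
      simpa using H.add_mem_cancel_right (H.neg_mem hh)
    rw [hB, ← hinv H hHmeager h, hHh]
  have hadd : ∀ h ∈ H, ∀ b ∈ B, b + h ∈ B := fun h hh b hb ↦
    hstab h hh ▸ Set.mem_image_of_mem _ hb
  have hBc : volume Bᶜ = 0 :=
    measure_compl_eq_zero_of_dense_add_mem volume (H.dense_of_addHaar_ne_zero volume hHnotnull)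
      hmeas hadd fun h0 ↦ hHnotnull (measure_mono_null hsub h0)
  obtain ⟨c, hc⟩ : (Bᶜ).Nonempty := (dense_of_mem_residual hBmeager).nonempty
  have hcoset : (c + ·) '' (H : Set (Fin n → ℝ)) ⊆ Bᶜ := by
    rintro _ ⟨h, hh, rfl⟩ hch
    exact hc (by simpa using hadd (-h) (H.neg_mem hh) _ hch)
  have hnull := measure_mono_null hcoset hBc
  rw [Set.image_add_left, measure_preimage_add] at hnull
  exact hHnotnull hnull
end

section
/- If non(𝒩) > non(ℳ), then there exists a ℚ-linear subspace of ℝⁿ (viewing ℝⁿ as a vector space over the field ℚ of rational numbers) that is Lebesgue null and non-meager. -/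
open MeasureTheory Cardinal

/-- `non(ℐ)`: the least cardinality of a set of reals not in the ideal `I`. -/
noncomputable def idealNon {X : Type*} (I : Set (Set X)) : Cardinal :=
  sInf {c : Cardinal | ∃ A : Set X, A ∉ I ∧ #A = c}

/-- A set with fewer elements than `non(ℐ)` belongs to `ℐ`. -/
theorem mem_of_mk_lt_idealNon {X : Type*} {I : Set (Set X)} {A : Set X}
    (hA : #A < idealNon I) : A ∈ I := by
  by_contra hmem
  have hle : idealNon I ≤ #A := csInf_le' ⟨A, hmem, rfl⟩
  exact hle.not_gt hA

/-- The value `non(ℐ)` is attained as soon as `ℐ` is not the whole power set. -/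
theorem exists_notMem_mk_eq_idealNon {X : Type*} {I : Set (Set X)} {B : Set X} (hB : B ∉ I) :
    ∃ A : Set X, A ∉ I ∧ #A = idealNon I :=
  csInf_mem (s := {c : Cardinal | ∃ A : Set X, A ∉ I ∧ #A = c}) ⟨#B, B, hB, rfl⟩

/-- The `ℚ`-span of `A` has at most `max #A ℵ₀` elements. -/
theorem mk_rat_span_le {V : Type*} [AddCommGroup V] [Module ℚ V] (A : Set V) :
    #(Submodule.span ℚ A) ≤ max #A ℵ₀ := by
  have hle : #(Submodule.span ℚ A) ≤ #(A →₀ ℚ) := by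
    rw [Finsupp.span_eq_range_linearCombination]
    exact mk_le_of_surjective (LinearMap.surjective_rangeRestrict _)
  refine hle.trans ?_
  rcases finite_or_infinite A with hfin | hinf
  · exact (mk_le_aleph0_iff.mpr inferInstance).trans (le_max_right _ _)
  · simp

/-- If `non(𝒩) > non(ℳ)`, then there is a `ℚ`-linear subspace of `ℝⁿ`
that is Lebesgue null and non-meager. -/
theorem exists_null_nonmeager_subspace_of_non_gt (n : ℕ) (hn : 1 ≤ n)
    (h : idealNon {A : Set (Fin n → ℝ) | volume A = 0} >
      idealNon {A : Set (Fin n → ℝ) | IsMeagre A}) :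
    ∃ H : Submodule ℚ (Fin n → ℝ),
      volume (H : Set (Fin n → ℝ)) = 0 ∧ ¬ IsMeagre (H : Set (Fin n → ℝ)) := by
  have : Nonempty (Fin n) := ⟨⟨0, hn⟩⟩
  obtain ⟨A, hA, hcard⟩ := exists_notMem_mk_eq_idealNon
    (I := {A : Set (Fin n → ℝ) | IsMeagre A}) (B := Set.univ)
    (not_isMeagre_of_isOpen isOpen_univ Set.univ_nonempty)
  refine ⟨Submodule.span ℚ A, ?_, fun hm => hA (hm.mono Submodule.subset_span)⟩
  have hspan := mk_rat_span_le A
  rcases le_total #A ℵ₀ with hc | hc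
  · rw [max_eq_right hc] at hspan
    exact (le_aleph0_iff_set_countable.mp hspan).measure_zero volume
  · rw [max_eq_left hc, hcard] at hspan
    exact mem_of_mk_lt_idealNon (hspan.trans_lt h)
end

section
/- If non(ℳ) > non(𝒩), then there exists a ℚ-linear subspace of ℝⁿ (viewing ℝⁿ as a vector space over the field ℚ of rational numbers) that is meager and not Lebesgue null. -/
open MeasureTheory Cardinal

/-- The rational span of an infinite set has cardinality at most that of the set. -/
theorem mk_rat_span_le_of_infinite {V : Type*} [AddCommGroup V] [Module ℚ V] (A : Set V)
    (hA : A.Infinite) : #(Submodule.span ℚ A) ≤ #A := by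
  have : Infinite A := hA.to_subtype
  have hr : Set.range (Finsupp.linearCombination ℚ ((↑) : A → V)) =
      (Submodule.span ℚ A : Set V) := by
    rw [← LinearMap.coe_range, Finsupp.range_linearCombination, Subtype.range_coe]
  calc #(Submodule.span ℚ A) = #(Set.range (Finsupp.linearCombination ℚ ((↑) : A → V))) := by
        rw [hr]; rfl
    _ ≤ #(A →₀ ℚ) := mk_range_le
    _ = #A := by
        rw [mk_finsupp_lift_of_infinite, lift_uzero, Cardinal.mkRat, lift_aleph0,
          max_eq_left (aleph0_le_mk A)]

/-- If `non(ℳ) > non(𝒩)`, then there is a `ℚ`-linear subspace of `ℝⁿ`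
that is meager and not Lebesgue null. -/
theorem exists_meager_nonnull_subspace_of_non_gt (n : ℕ) (hn : 1 ≤ n)
    (h : idealNon {A : Set (Fin n → ℝ) | IsMeagre A} >
      idealNon {A : Set (Fin n → ℝ) | volume A = 0}) :
    ∃ H : Submodule ℚ (Fin n → ℝ),
      IsMeagre (H : Set (Fin n → ℝ)) ∧ volume (H : Set (Fin n → ℝ)) ≠ 0 := by
  have : Nonempty (Fin n) := ⟨⟨0, hn⟩⟩
  obtain ⟨A, hA, hc⟩ : idealNon {A : Set (Fin n → ℝ) | volume A = 0} ∈
      {c : Cardinal | ∃ A : Set (Fin n → ℝ), A ∉ {A : Set (Fin n → ℝ) | volume A = 0} ∧ #A = c} :=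
    csInf_mem ⟨_, Set.univ, isOpen_univ.measure_ne_zero volume Set.univ_nonempty, rfl⟩
  have hAinf : A.Infinite := fun hf => hA (hf.measure_zero volume)
  refine ⟨Submodule.span ℚ A, ?_, fun h0 => hA (measure_mono_null Submodule.subset_span h0)⟩
  by_contra hM
  have hle : idealNon {A : Set (Fin n → ℝ) | IsMeagre A} ≤ #(Submodule.span ℚ A) :=
    csInf_le' ⟨_, hM, rfl⟩
  exact (hle.trans ((mk_rat_span_le_of_infinite A hAinf).trans hc.le)).not_gt h
end

section
/- If cov*(ℳ) ≥ cof(ℳ), then there exists a ℚ-linear subspace H of ℝⁿ (viewing ℝⁿ as a vector space over the field ℚ of rational numbers) such that H is Lebesgue null and non-meager. -/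
open MeasureTheory Cardinal Pointwise

/-- `cof(ℐ)`: the least cardinality of a family `F ⊆ I` cofinal in `I` under inclusion. -/
noncomputable def idealCof {X : Type*} (I : Set (Set X)) : Cardinal :=
  sInf {c : Cardinal | ∃ F : Set (Set X), F ⊆ I ∧ (∀ A ∈ I, ∃ B ∈ F, A ⊆ B) ∧ #F = c}

/-- `cov*(ℐ)`: the least cardinality of a set `A` such that `A + B = ℝⁿ` for some `B ∈ I`. -/
noncomputable def idealCovStar {X : Type*} [Add X] (I : Set (Set X)) : Cardinal :=
  sInf {c : Cardinal | ∃ A : Set X, (∃ B ∈ I, A + B = Set.univ) ∧ #A = c}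

open Set in
/-- Transfinite choice: if `P i S` can always be met for sets `S` no larger than `Iio i`, some
function `f` meets `P i (f '' Iio i)` at every `i`. -/
theorem exists_forall_image_Iio {ι X : Type} [Preorder ι] [WellFoundedLT ι] [Nonempty X]
    (P : ι → Set X → X → Prop) (hP : ∀ i, ∀ S : Set X, #S ≤ #(Iio i) → ∃ x, P i S x) :
    ∃ f : ι → X, ∀ i, P i (f '' Iio i) (f i) := by
  classical
  let g : ι → Set X → X := fun i S ↦ Classical.epsilon (P i S)
  let f : ι → X := (wellFounded_lt (α := ι)).fix fun i rec ↦ g i (range fun j : Iio i ↦ rec j j.2)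
  refine ⟨f, fun i ↦ ?_⟩
  have hf : f i = g i (f '' Iio i) := by
    rw [image_eq_range]
    exact (wellFounded_lt (α := ι)).fix_eq _ i
  rw [hf]
  exact Classical.epsilon_spec (hP i _ mk_image_le)

/-- The `ℚ`-span of `S` is countable or no larger than `S`. -/
theorem mk_span_rat_le {V : Type} [AddCommGroup V] [Module ℚ V] (S : Set V) :
    #(Submodule.span ℚ S) ≤ max #S ℵ₀ := by
  have h : Function.Surjective (Finsupp.linearCombination ℚ ((↑) : S → V)).rangeRestrict :=
    LinearMap.surjective_rangeRestrict _
  have h' := mk_le_of_surjective h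
  rw [Finsupp.range_linearCombination, Subtype.range_coe] at h'
  refine h'.trans ?_
  cases isEmpty_or_nonempty S
  · exact le_max_of_le_right (mk_le_aleph0 (α := S →₀ ℚ))
  · simp

/-- If each `f i` avoids `M` robustly modulo the span of its predecessors, then all nonzero vectors
of the span of `f` avoid `M`. -/
theorem notMem_of_mem_span_range {ι V : Type} [LinearOrder ι] [AddCommGroup V] [Module ℚ V]
    {M : Set V} {f : ι → V}
    (hf : ∀ i, ∀ q : ℚ, q ≠ 0 → ∀ s ∈ Submodule.span ℚ (f '' Set.Iio i), q • f i + s ∉ M)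
    {x : V} (hx : x ∈ Submodule.span ℚ (Set.range f)) (hx0 : x ≠ 0) : x ∉ M := by
  obtain ⟨c, rfl⟩ := Finsupp.mem_span_range_iff_exists_finsupp.1 hx
  induction c using Finsupp.induction_on_max with
  | zero => simp at hx0
  | single_add i q c hc hq _ =>
    rw [Finsupp.sum_add_index' (by simp) (by simp [add_smul]), Finsupp.sum_single_index (by simp)]
    exact hf i q hq _ (Submodule.sum_mem _ fun j hj ↦ Submodule.smul_mem _ _
      (Submodule.subset_span ⟨j, hc j hj, rfl⟩))

theorem IsMeagre.preimage_rat_smul {n : ℕ} {M : Set (Fin n → ℝ)} (hM : IsMeagre M) {q : ℚ}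
    (hq : q ≠ 0) : IsMeagre ((fun x ↦ q • x) ⁻¹' M) := by
  have hq' : (q : ℝ) ≠ 0 := Rat.cast_ne_zero.2 hq
  have h : (fun x : Fin n → ℝ ↦ q • x) = fun x ↦ (q : ℝ) • x := by
    ext x i
    simp [Rat.smul_def]
  rw [h]
  exact hM.preimage_of_isOpenMap (continuous_const_smul _) (isOpenMap_smul₀ hq')

theorem exists_isMeagre_volume_compl_eq_zero {n : ℕ} (hn : 1 ≤ n) :
    ∃ M : Set (Fin n → ℝ), IsMeagre M ∧ volume Mᶜ = 0 := by
  let p : (Fin n → ℝ) → ℝ := Function.eval ⟨0, hn⟩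
  have hM : IsMeagre {x : ℝ | Liouville x}ᶜ := by
    rw [IsMeagre, compl_compl]
    exact eventually_residual_liouville
  refine ⟨p ⁻¹' {x | Liouville x}ᶜ,
    hM.preimage_of_isOpenMap (continuous_apply _) (isOpenMap_eval _), ?_⟩
  have h := (Measure.quasiMeasurePreserving_eval (fun _ : Fin n ↦ (volume : Measure ℝ))
    ⟨0, hn⟩).preimage_null volume_setOfPred_liouville
  rwa [Set.preimage_compl, compl_compl]

/-- A countable set, or one smaller than `idealCovStar`, does not translate a meagre set onto the
whole space. -/
theorem add_isMeagre_ne_univ {n : ℕ} {A B : Set (Fin n → ℝ)} (hB : IsMeagre B)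
    (hA : A.Countable ∨ #A < idealCovStar {A : Set (Fin n → ℝ) | IsMeagre A}) :
    A + B ≠ Set.univ := by
  intro h
  rcases hA with hA | hA
  · refine not_isMeagre_of_isOpen (X := Fin n → ℝ) isOpen_univ Set.univ_nonempty ?_
    rw [← h, ← Set.iUnion_add_left_image]
    refine isMeagre_biUnion hA fun a _ ↦ ?_
    rw [Set.image_add_left]
    exact hB.preimage_of_isOpenMap (continuous_const_add _) (isOpenMap_add_left _)
  · exact notMem_of_lt_csInf' hA ⟨A, ⟨B, hB, h⟩, rfl⟩

/-- If `cov*(ℳ) ≥ cof(ℳ)`, then there exists a `ℚ`-linear subspace `H` of `ℝⁿ`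
which is Lebesgue null and non-meager. -/
theorem exists_null_nonmeager_subspace_of_covStar_ge_cof (n : ℕ) (hn : 1 ≤ n)
    (h : idealCovStar {A : Set (Fin n → ℝ) | IsMeagre A} ≥
      idealCof {A : Set (Fin n → ℝ) | IsMeagre A}) :
    ∃ H : Submodule ℚ (Fin n → ℝ),
      volume (H : Set (Fin n → ℝ)) = 0 ∧ ¬ IsMeagre (H : Set (Fin n → ℝ)) := by
  have : Nonempty (Fin n) := ⟨⟨0, hn⟩⟩
  obtain ⟨M, hM, hM0⟩ := exists_isMeagre_volume_compl_eq_zero hn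
  obtain ⟨F, hF, hcof, hcard⟩ : idealCof {A : Set (Fin n → ℝ) | IsMeagre A} ∈ _ :=
    csInf_mem ⟨_, _, subset_rfl, fun A hA ↦ ⟨A, hA, subset_rfl⟩, rfl⟩
  rw [← hcard] at h
  let ι := (#F).ord.ToType
  obtain ⟨e⟩ : Nonempty (ι ≃ F) := Cardinal.eq.1 (mk_ord_toType _)
  let M' := ⋃ q : {q : ℚ // q ≠ 0}, (fun x ↦ q.1 • x) ⁻¹' M
  have hM' : IsMeagre M' := isMeagre_iUnion fun q ↦ hM.preimage_rat_smul q.2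
  obtain ⟨f, hf⟩ := exists_forall_image_Iio (ι := ι) (X := Fin n → ℝ)
    (fun i S x ↦ x ∉ (e i).1 ∧ ∀ q : ℚ, q ≠ 0 → ∀ s ∈ Submodule.span ℚ S, q • x + s ∉ M) <| by
    intro i S hS
    have hS' : #S < #F := hS.trans_lt ((mk_Iio_lt i (by simp [ι])).trans_eq (mk_ord_toType _))
    have hT : (Submodule.span ℚ S : Set (Fin n → ℝ)).Countable ∨
        #(Submodule.span ℚ S) < idealCovStar {A : Set (Fin n → ℝ) | IsMeagre A} := by
      rcases le_total #S ℵ₀ with hc | hc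
      · exact .inl (le_aleph0_iff_set_countable.1 ((mk_span_rat_le S).trans (by simp [hc])))
      · exact .inr (((mk_span_rat_le S).trans (by simp [hc])).trans_lt (hS'.trans_le h))
    obtain ⟨x, hx⟩ := (Set.ne_univ_iff_exists_notMem _).1
      (add_isMeagre_ne_univ (hM'.union (hF (e i).2)) hT)
    refine ⟨x, fun hxe ↦ hx ⟨0, zero_mem _, x, .inr hxe, zero_add x⟩, fun q hq s hs hxs ↦ hx ?_⟩
    refine ⟨-(q⁻¹ • s), neg_mem (Submodule.smul_mem _ _ hs), x + q⁻¹ • s,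
      .inl (Set.mem_iUnion.2 ⟨⟨q, hq⟩, ?_⟩), by simp⟩
    simpa [smul_smul, hq] using hxs
  refine ⟨Submodule.span ℚ (Set.range f), ?_, fun hH ↦ ?_⟩
  · refine measure_mono_null (t := {0} ∪ Mᶜ) (fun x hx ↦ ?_)
      (measure_union_null (measure_singleton _) hM0)
    exact or_iff_not_imp_left.2 fun hx0 ↦ notMem_of_mem_span_range (fun i ↦ (hf i).2) hx hx0
  · obtain ⟨B, hB, hHB⟩ := hcof _ hH
    refine (hf (e.symm ⟨B, hB⟩)).1 ?_
    rw [e.apply_symm_apply]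
    exact hHB (Submodule.subset_span ⟨_, rfl⟩)
end

section
/- If cov*(𝒩) ≥ cof(𝒩), then there exists a ℚ-linear subspace H of ℝⁿ (viewing ℝⁿ as a vector space over the field ℚ of rational numbers) such that H is meager and not Lebesgue null. -/
open MeasureTheory Cardinal Pointwise

lemma exists_residual_null_rat_smul_invariant (n : ℕ) (hn : 1 ≤ n) :
    ∃ G : Set (Fin n → ℝ), G ∈ residual (Fin n → ℝ) ∧ volume G = 0 ∧ (0 : Fin n → ℝ) ∉ G ∧
      ∀ q : ℚ, q ≠ 0 → ∀ x ∈ G, q • x ∈ G := by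
  have : Nonempty (Fin n) := ⟨⟨0, hn⟩⟩
  obtain ⟨D, hDc, hDd⟩ := TopologicalSpace.exists_countable_dense (Fin n → ℝ)
  have hD0 : volume D = 0 := hDc.measure_zero _
  have hU (k : ℕ) : ∃ U ⊇ D, IsOpen U ∧ volume U < ((k : ENNReal) + 1)⁻¹ :=
    D.exists_isOpen_lt_of_lt _ (by simp [hD0])
  choose U hUD hUo hUm using hU
  set G₀ : Set (Fin n → ℝ) := ⋂ k, U k
  have hG₀r : G₀ ∈ residual (Fin n → ℝ) :=
    countable_iInter_mem.2 fun k => residual_of_dense_open (hUo k) (hDd.mono (hUD k))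
  have hG₀ : volume G₀ = 0 := by
    by_contra hne
    obtain ⟨k, hk⟩ := ENNReal.exists_inv_nat_lt hne
    have h1 : volume G₀ ≤ ((k : ENNReal) + 1)⁻¹ :=
      (measure_mono (Set.iInter_subset _ k)).trans (hUm k).le
    have h2 : ((k : ENNReal) + 1)⁻¹ ≤ (k : ENNReal)⁻¹ := ENNReal.inv_le_inv.2 le_self_add
    exact absurd (h1.trans h2) (not_le.2 hk)
  have h0r : ({0}ᶜ : Set (Fin n → ℝ)) ∈ residual (Fin n → ℝ) :=
    residual_of_dense_open isOpen_compl_singleton (dense_compl_singleton 0)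
  refine ⟨(⋃ q : {q : ℚ // q ≠ 0}, (((q : ℚ) : ℝ) • G₀)) ∩ {0}ᶜ, ?_, ?_, by simp, ?_⟩
  · refine Filter.inter_mem (Filter.mem_of_superset hG₀r ?_) h0r
    intro x hx
    exact Set.mem_iUnion.2 ⟨⟨1, one_ne_zero⟩, by simpa using hx⟩
  · refine measure_mono_null Set.inter_subset_left (measure_iUnion_null fun q => ?_)
    rw [Measure.addHaar_smul, hG₀, mul_zero]
  · rintro q hq x ⟨hx, hx0⟩
    obtain ⟨r, y, hy, rfl⟩ := Set.mem_iUnion.1 hx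
    refine ⟨Set.mem_iUnion.2 ⟨⟨q * r, mul_ne_zero hq r.2⟩, y, hy, ?_⟩, ?_⟩
    · ext i
      simp [Rat.smul_def, mul_assoc]
    · exact smul_ne_zero hq hx0

/-- A cofinal family of null sets is uncountable when singletons are null and `μ ≠ 0`. -/
lemma aleph0_lt_of_cofinal_null {X : Type*} [MeasurableSpace X] (μ : Measure X) [NeZero μ]
    [NullSingletonClass μ] {F : Set (Set X)} (hF : ∀ B ∈ F, μ B = 0)
    (hcof : ∀ A, μ A = 0 → ∃ B ∈ F, A ⊆ B) : ℵ₀ < #F := by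
  by_contra hle
  have hc : F.Countable := by simpa using hle
  have huniv : ⋃₀ F = Set.univ := by
    refine Set.eq_univ_of_forall fun x => ?_
    obtain ⟨B, hB, hxB⟩ := hcof {x} (measure_singleton x)
    exact ⟨B, hB, hxB rfl⟩
  have := (measure_sUnion_null_iff hc).2 hF
  rw [huniv] at this
  exact NeZero.ne μ (Measure.measure_univ_eq_zero.1 this)

lemma mk_rat_span_lt {E : Type} [AddCommGroup E] [Module ℚ E] {κ : Cardinal} (hκ : ℵ₀ < κ)
    {s : Set E} (hs : #s < κ) : #(Submodule.span ℚ s) < κ := by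
  have h : #(Submodule.span ℚ s) ≤ #(s →₀ ℚ) := by
    rw [Finsupp.span_eq_range_linearCombination]
    exact mk_le_of_surjective (LinearMap.surjective_rangeRestrict _)
  refine h.trans_lt ?_
  cases isEmpty_or_nonempty s
  · exact (mk_le_aleph0).trans_lt hκ
  · rw [mk_finsupp_of_infinite']
    exact max_lt hs (by simpa using hκ)

/-- Greedy transfinite construction of a sequence with each term constrained by its predecessors. -/
lemma exists_seq_of_forall_exists {ι E : Type*} [LinearOrder ι] [WellFoundedLT ι] [Nonempty E]
    (P : ι → Set E → E → Prop) (hP : ∀ i (f : ι → E), ∃ y, P i (f '' Set.Iio i) y) :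
    ∃ x : ι → E, ∀ i, P i (x '' Set.Iio i) (x i) := by
  let F : (i : ι) → ((j : ι) → j < i → E) → E := fun i f =>
    Classical.epsilon fun y => P i {z | ∃ j, ∃ hj : j < i, f j hj = z} y
  let x : ι → E := (wellFounded_lt (α := ι)).fix F
  refine ⟨x, fun i => ?_⟩
  have hx : x i = F i fun j _ => x j := WellFounded.fix_eq _ F i
  have hset : {z | ∃ j, ∃ _ : j < i, x j = z} = x '' Set.Iio i := by
    ext z
    simp
  have hex := hP i x
  rw [← hset] at hex ⊢
  rw [hx]
  exact Classical.epsilon_spec hex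

/-- A rational span avoids `G` if each generator avoids the translates of `G` by the span of
the preceding generators. -/
lemma disjoint_span_range {ι E : Type*} [LinearOrder ι] [AddCommGroup E] [Module ℚ E]
    {G : Set E} (h0 : (0 : E) ∉ G) (hG : ∀ q : ℚ, q ≠ 0 → ∀ y ∈ G, q • y ∈ G) {x : ι → E}
    (hx : ∀ i, x i ∉ (Submodule.span ℚ (x '' Set.Iio i) : Set E) + G) :
    Disjoint (Submodule.span ℚ (Set.range x) : Set E) G := by
  refine Set.disjoint_left.2 fun y hy hyG => ?_
  obtain ⟨c, rfl⟩ := (Finsupp.mem_span_range_iff_exists_finsupp).1 hy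
  have hne : c.support.Nonempty := by
    rw [Finset.nonempty_iff_ne_empty]
    intro he
    apply h0
    simpa [Finsupp.sum, he] using hyG
  set m := c.support.max' hne
  have hm : m ∈ c.support := c.support.max'_mem hne
  have hcm : c m ≠ 0 := Finsupp.mem_support_iff.1 hm
  set t := ∑ i ∈ c.support.erase m, c i • x i with ht_def
  have hsum : (c.sum fun i a => a • x i) = c m • x m + t :=
    (Finset.add_sum_erase c.support (fun i => c i • x i) hm).symm
  have ht : t ∈ Submodule.span ℚ (x '' Set.Iio m) := by
    refine Submodule.sum_mem _ fun i hi => Submodule.smul_mem _ _ (Submodule.subset_span ?_)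
    exact ⟨i, lt_of_le_of_ne (c.support.le_max' i (Finset.mem_of_mem_erase hi))
      (Finset.ne_of_mem_erase hi), rfl⟩
  refine hx m ⟨-((c m)⁻¹ • t), Submodule.neg_mem _ (Submodule.smul_mem _ _ ht),
    (c m)⁻¹ • (c m • x m + t), hG _ (inv_ne_zero hcm) _ (hsum ▸ hyG), ?_⟩
  simp [smul_add, smul_smul, inv_mul_cancel₀ hcm]

/-- If `cov*(𝒩) ≥ cof(𝒩)`, then there exists a `ℚ`-linear subspace `H` of `ℝⁿ`
which is meager and not Lebesgue null. -/
theorem exists_meager_nonnull_subspace_of_covStar_ge_cof (n : ℕ) (hn : 1 ≤ n)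
    (h : idealCovStar {A : Set (Fin n → ℝ) | volume A = 0} ≥
      idealCof {A : Set (Fin n → ℝ) | volume A = 0}) :
    ∃ H : Submodule ℚ (Fin n → ℝ),
      IsMeagre (H : Set (Fin n → ℝ)) ∧ volume (H : Set (Fin n → ℝ)) ≠ 0 := by
  have : Nonempty (Fin n) := ⟨⟨0, hn⟩⟩
  obtain ⟨G, hGr, hG0, h0G, hGq⟩ := exists_residual_null_rat_smul_invariant n hn
  set I := {A : Set (Fin n → ℝ) | volume A = 0}
  obtain ⟨F, hFI, hcof, hFc⟩ : idealCof I ∈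
      {c : Cardinal | ∃ F : Set (Set (Fin n → ℝ)), F ⊆ I ∧ (∀ A ∈ I, ∃ B ∈ F, A ⊆ B) ∧ #F = c} :=
    csInf_mem ⟨_, I, subset_rfl, fun A hA => ⟨A, hA, subset_rfl⟩, rfl⟩
  rw [← hFc] at h
  have hF : ℵ₀ < #F := aleph0_lt_of_cofinal_null volume hFI hcof
  have hcov : ∀ A : Set (Fin n → ℝ), #A < #F → ∀ B, volume B = 0 → ∃ y, y ∉ A + B := by
    intro A hA B hB
    by_contra! hy
    exact absurd (h.trans (csInf_le' ⟨A, ⟨B, hB, Set.eq_univ_of_forall hy⟩, rfl⟩)) (not_le.2 hA)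
  obtain ⟨e⟩ : Nonempty ((#F).ord.ToType ≃ F) := Cardinal.eq.1 (mk_ord_toType _)
  obtain ⟨x, hx⟩ := exists_seq_of_forall_exists
    (fun (i : (#F).ord.ToType) s y =>
      y ∉ (Submodule.span ℚ s : Set (Fin n → ℝ)) + (G ∪ (e i : Set (Fin n → ℝ))))
    fun i f => hcov _ (mk_rat_span_lt hF (mk_image_le.trans_lt (mk_Iio_toType_ord_lt i))) _
      (measure_union_null hG0 (hFI (e i).2))
  refine ⟨Submodule.span ℚ (Set.range x), ?_, fun hnull => ?_⟩
  · refine Filter.mem_of_superset hGr (Set.disjoint_right.1 (disjoint_span_range h0G hGq ?_))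
    exact fun i hi => hx i (Set.add_subset_add_left Set.subset_union_left hi)
  · obtain ⟨B, hB, hHB⟩ := hcof _ hnull
    refine hx (e.symm ⟨B, hB⟩) ⟨0, Submodule.zero_mem _, x (e.symm ⟨B, hB⟩), Or.inr ?_, zero_add _⟩
    rw [e.apply_symm_apply]
    exact hHB (Submodule.subset_span ⟨_, rfl⟩)
end

section
/- Let κ be an infinite cardinal. If cov(ℳ) = cof(ℳ) = κ, then there exists a ℚ-linear subspace H of ℝⁿ (viewing ℝⁿ as a vector space over the field ℚ of rational numbers) that is a κ-Luzin set, i.e., a κ-Luzin set for ℳ. -/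
open MeasureTheory Cardinal

/-- `cov(ℐ)`: the least cardinality of a family `F ⊆ I` covering the whole space. -/
noncomputable def idealCov {X : Type*} (I : Set (Set X)) : Cardinal :=
  sInf {c : Cardinal | ∃ F : Set (Set X), F ⊆ I ∧ ⋃₀ F = Set.univ ∧ #F = c}

theorem exists_cofinal_of_idealCof {X : Type*} (I : Set (Set X)) :
    ∃ F : Set (Set X), F ⊆ I ∧ (∀ A ∈ I, ∃ B ∈ F, A ⊆ B) ∧ #F = idealCof I :=
  csInf_mem (s := {c : Cardinal | ∃ F : Set (Set X), F ⊆ I ∧ (∀ A ∈ I, ∃ B ∈ F, A ⊆ B) ∧ #F = c})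
    ⟨#I, I, subset_rfl, fun A hA => ⟨A, hA, subset_rfl⟩, rfl⟩

theorem exists_forall_notMem_of_mk_lt_idealCov {X J : Type*} {I : Set (Set X)} (A : J → Set X)
    (hA : ∀ j, A j ∈ I) (hJ : #(Set.range A) < idealCov I) :
    ∃ y, ∀ j, y ∉ A j := by
  by_contra! h
  refine hJ.not_ge (csInf_le' ⟨Set.range A, ?_, ?_, rfl⟩)
  · rintro _ ⟨j, rfl⟩
    exact hA j
  · rw [Set.sUnion_range]
    exact Set.eq_univ_of_forall fun y => Set.mem_iUnion.2 (h y)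

theorem aleph0_lt_idealCov_isMeagre {X : Type*} [TopologicalSpace X] [BaireSpace X] [Nonempty X]
    (hcov : ⋃₀ {A : Set X | IsMeagre A} = Set.univ) :
    ℵ₀ < idealCov {A : Set X | IsMeagre A} := by
  obtain ⟨F, hF, hFU, hc⟩ := csInf_mem
    (s := {c : Cardinal | ∃ F : Set (Set X), F ⊆ {A | IsMeagre A} ∧ ⋃₀ F = Set.univ ∧ #F = c})
    ⟨_, _, subset_rfl, hcov, rfl⟩
  by_contra! h
  have : Countable F := Cardinal.mk_le_aleph0_iff.1 (hc.trans_le h)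
  refine not_isMeagre_of_isOpen (X := X) isOpen_univ Set.univ_nonempty ?_
  rw [← hFU, Set.sUnion_eq_iUnion]
  exact isMeagre_iUnion fun i => hF i.2

theorem isMeagre_singleton {X : Type*} [TopologicalSpace X] [T1Space X] (x : X)
    [(nhdsWithin x {x}ᶜ).NeBot] : IsMeagre ({x} : Set X) := by
  refine IsNowhereDense.isMeagre (isClosed_singleton.isNowhereDense_iff.2 ?_)
  exact interior_singleton x

theorem isMeagre_preimage_smul_add {E : Type*} [AddCommGroup E] [Module ℚ E] [TopologicalSpace E]
    [ContinuousAdd E] [ContinuousConstSMul ℚ E] {q : ℚ} (hq : q ≠ 0) (h : E) {A : Set E}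
    (hA : IsMeagre A) : IsMeagre ((fun y => q • y + h) ⁻¹' A) := by
  let e : E ≃ₜ E := (Homeomorph.smulOfNeZero q hq).trans (Homeomorph.addRight h)
  exact hA.preimage_of_isOpenMap e.continuous e.isOpenMap

theorem Cardinal.mk_span_image_lt.{u} {R ι E : Type u} [Ring R] [Countable R] [AddCommGroup E]
    [Module R E] {κ : Cardinal.{u}} (hκ : ℵ₀ < κ) (x : ι → E) {s : Set ι} (hs : #s < κ) :
    #(Submodule.span R (x '' s)) < κ := by
  have hle : #(Submodule.span R (x '' s)) ≤ #(s →₀ R) := by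
    rw [Set.image_eq_range, ← Finsupp.range_linearCombination]
    exact Cardinal.mk_range_le
  refine hle.trans_lt ?_
  rcases finite_or_infinite s with _ | _
  · exact Cardinal.mk_le_aleph0.trans_lt hκ
  · rcases subsingleton_or_nontrivial R with _ | _
    · exact Cardinal.mk_le_aleph0.trans_lt hκ
    · rw [Cardinal.mk_finsupp_of_infinite]
      exact max_lt hs (Cardinal.mk_le_aleph0.trans_lt hκ)

theorem Submodule.mem_span_range_eq_zero_or_exists {K ι E : Type*} [LinearOrder ι] [Ring K]
    [AddCommGroup E] [Module K E] (x : ι → E) {h : E} (hh : h ∈ Submodule.span K (Set.range x)) :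
    h = 0 ∨ ∃ a : ι, ∃ q : K, q ≠ 0 ∧ ∃ h' ∈ Submodule.span K (x '' Set.Iio a), h = q • x a + h' := by
  classical
  obtain ⟨c, rfl⟩ := Finsupp.mem_span_range_iff_exists_finsupp.1 hh
  rcases c.support.eq_empty_or_nonempty with hc | hc
  · left
    simp [Finsupp.support_eq_empty.1 hc]
  · right
    set a := c.support.max' hc
    have ha : a ∈ c.support := Finset.max'_mem _ hc
    refine ⟨a, c a, Finsupp.mem_support_iff.1 ha, ∑ i ∈ c.support.erase a, c i • x i, ?_, ?_⟩
    · refine Submodule.sum_mem _ fun i hi => Submodule.smul_mem _ _ (Submodule.subset_span ⟨i, ?_, rfl⟩)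
      obtain ⟨hne, hi⟩ := Finset.mem_erase.1 hi
      exact lt_of_le_of_ne (Finset.le_max' _ i hi) hne
    · exact (Finset.add_sum_erase c.support (fun i => c i • x i) ha).symm

/-- If `cov(ℳ) = cof(ℳ) = κ`, then there exists a `ℚ`-linear subspace `H` of `ℝⁿ`
which is a `κ`-Luzin set, i.e. a `κ`-Luzin set for `ℳ`. -/
theorem exists_luzin_subspace (n : ℕ) (hn : 1 ≤ n) (κ : Cardinal) (hκ : ℵ₀ ≤ κ)
    (hcov : idealCov {A : Set (Fin n → ℝ) | IsMeagre A} = κ)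
    (hcof : idealCof {A : Set (Fin n → ℝ) | IsMeagre A} = κ) :
    ∃ H : Submodule ℚ (Fin n → ℝ),
      κ ≤ #(H : Set (Fin n → ℝ)) ∧
      ∀ B : Set (Fin n → ℝ), IsMeagre B → #(↥((H : Set (Fin n → ℝ)) ∩ B)) < κ := by
  have : Nonempty (Fin n) := ⟨⟨0, hn⟩⟩
  have hsingle (y : Fin n → ℝ) : IsMeagre ({y} : Set (Fin n → ℝ)) := isMeagre_singleton y
  have hκ₁ : ℵ₀ < κ := hcov ▸ aleph0_lt_idealCov_isMeagre
    (Set.eq_univ_of_forall fun y => ⟨{y}, hsingle y, rfl⟩)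
  obtain ⟨F, hF, hFcof, hFcard⟩ := exists_cofinal_of_idealCof {A : Set (Fin n → ℝ) | IsMeagre A}
  obtain ⟨e⟩ : Nonempty (κ.ord.ToType ≃ F) := by
    rw [← Cardinal.eq, hFcard, hcof, Cardinal.mk_ord_toType]
  have hIio (a : κ.ord.ToType) : #(Set.Iio a) < κ := by
    simpa using Cardinal.mk_Iio_lt a (by simp)
  have hIic (a : κ.ord.ToType) : #(Set.Iic a) < κ := by
    rw [← Set.Iio_union_right]
    exact (Cardinal.mk_union_le _ _).trans_lt
      (Cardinal.add_lt_of_lt hκ (hIio a)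
        (by simpa using Cardinal.one_lt_aleph0.trans_le hκ))
  have hspan (x : κ.ord.ToType → Fin n → ℝ) (a : κ.ord.ToType) :
      #(Submodule.span ℚ (x '' Set.Iio a)) < κ :=
    Cardinal.mk_span_image_lt hκ₁ x (hIio a)
  have hstep (a : κ.ord.ToType) (x : κ.ord.ToType → Fin n → ℝ) :
      ∃ y, ∀ h ∈ Submodule.span ℚ (x '' Set.Iio a), ∀ b ≤ a, ∀ q : ℚ, q ≠ 0 →
        q • y + h ∉ (e b : Set (Fin n → ℝ)) ∪ {0} := by
    obtain ⟨y, hy⟩ := exists_forall_notMem_of_mk_lt_idealCov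
      (I := {A : Set (Fin n → ℝ) | IsMeagre A})
      (fun j : (Submodule.span ℚ (x '' Set.Iio a) × Set.Iic a) × {q : ℚ // q ≠ 0} =>
        (fun y => j.2.1 • y + j.1.1.1) ⁻¹' ((e j.1.2.1 : Set (Fin n → ℝ)) ∪ {0}))
      (fun j => isMeagre_preimage_smul_add j.2.2 _ ((hF (e j.1.2.1).2).union (hsingle 0)))
      (by
        rw [hcov]
        refine Cardinal.mk_range_le.trans_lt ?_
        simp only [← Cardinal.mul_def]
        exact Cardinal.mul_lt_of_lt hκ (Cardinal.mul_lt_of_lt hκ (hspan x a) (hIic a))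
          (Cardinal.mk_le_aleph0.trans_lt hκ₁))
    exact ⟨y, fun h hh b hb q hq => hy ((⟨h, hh⟩, ⟨b, hb⟩), ⟨q, hq⟩)⟩
  choose g hg using hstep
  obtain ⟨x, hx⟩ : ∃ x : κ.ord.ToType → Fin n → ℝ, ∀ a, ∀ h ∈ Submodule.span ℚ (x '' Set.Iio a),
      ∀ b ≤ a, ∀ q : ℚ, q ≠ 0 → q • x a + h ∉ (e b : Set (Fin n → ℝ)) ∪ {0} := by
    classical
    let x : κ.ord.ToType → Fin n → ℝ := wellFounded_lt.fix fun a f =>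
      g a fun b => if hb : b < a then f b hb else 0
    refine ⟨x, fun a => ?_⟩
    have hxa : x a = g a fun b => if b < a then x b else 0 := by
      rw [show x a = _ from WellFounded.fix_eq _ _ _]
      simp [x]
    have himage : (fun b => if b < a then x b else 0) '' Set.Iio a = x '' Set.Iio a :=
      Set.image_congr fun b hb => if_pos hb
    rw [hxa, ← himage]
    exact hg a _
  have hnotMem (a : κ.ord.ToType) : x a ∉ Submodule.span ℚ (x '' Set.Iio a) := fun h =>
    hx a _ (neg_mem h) a le_rfl 1 one_ne_zero (by simp)
  have hinj : Function.Injective x := by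
    refine Function.Injective.of_lt_imp_ne fun a b hab h => hnotMem b ?_
    exact Submodule.subset_span ⟨a, hab, h⟩
  refine ⟨Submodule.span ℚ (Set.range x), ?_, fun B hB => ?_⟩
  · calc κ = #(Set.range x) := by rw [Cardinal.mk_range_eq x hinj, Cardinal.mk_ord_toType]
      _ ≤ _ := Cardinal.mk_le_mk_of_subset Submodule.subset_span
  · obtain ⟨A, hA, hBA⟩ := hFcof B hB
    obtain ⟨b, hb⟩ := e.surjective ⟨A, hA⟩
    refine (Cardinal.mk_le_mk_of_subset ?_).trans_lt (hspan x b)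
    rintro h ⟨hh, hhB⟩
    rcases Submodule.mem_span_range_eq_zero_or_exists x hh with rfl | ⟨a, q, hq, h', hh', rfl⟩
    · exact zero_mem _
    · have hab : a < b := by
        by_contra! hba
        exact hx a h' hh' b hba q hq (Or.inl (by rw [hb]; exact hBA hhB))
      refine add_mem (Submodule.smul_mem _ _ (Submodule.subset_span ⟨a, hab, rfl⟩))
        (Submodule.span_mono (Set.image_mono (Set.Iio_subset_Iio hab.le)) hh')
end

section
/- Let X be a Polish space and let ℬ be a countable base of open sets of X that is closed under finite intersections and contains X. If there exists a monotone Borel hull operation on ℳ with respect to ℳ, then there exists a ℬ-regular monotone Borel hull operation on ℳ with respect to ℳ. -/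
open MeasureTheory

/-- If there is a monotone Borel hull operation on the meager ideal of a Polish space `X`
(with respect to the meager ideal), then for every countable base `B` of `X` that is closed
under finite intersections and contains `X`, there is a `B`-regular monotone Borel hull
operation on the meager ideal. -/
theorem exists_regular_monotone_hull_of_monotone_hull {X : Type*} [TopologicalSpace X]
    [PolishSpace X] (B : Set (Set X)) (hBcount : B.Countable)
    (hBbasis : TopologicalSpace.IsTopologicalBasis B)
    (hBinter : ∀ U ∈ B, ∀ V ∈ B, U ∩ V ∈ B) (hBuniv : Set.univ ∈ B)
    (h : ∃ φ : Set X → Set X,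
      (∀ A : Set X, IsMeagre A →
        MeasurableSet[borel X] (φ A) ∧ A ⊆ φ A ∧ IsMeagre (φ A \ A)) ∧
      (∀ A A' : Set X, IsMeagre A → IsMeagre A' → A ⊆ A' → φ A ⊆ φ A')) :
    ∃ φ : Set X → Set X,
      (∀ A : Set X, IsMeagre A →
        MeasurableSet[borel X] (φ A) ∧ A ⊆ φ A ∧ IsMeagre (φ A \ A)) ∧
      (∀ A A' : Set X, IsMeagre A → IsMeagre A' → A ⊆ A' → φ A ⊆ φ A') ∧
      (∀ A : Set X, IsMeagre A → ∀ U ∈ B, φ A ∩ U ⊆ φ (A ∩ U)) := by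
  obtain ⟨φ, hφ, hmono⟩ := h
  have hinter : ∀ A U : Set X, IsMeagre A → IsMeagre (A ∩ U) := fun A U hA =>
    hA.mono Set.inter_subset_left
  refine ⟨fun A => ⋂ U ∈ B, (φ (A ∩ U) ∪ Uᶜ), fun A hA => ⟨?_, ?_, ?_⟩, ?_, ?_⟩
  · let _ : MeasurableSpace X := borel X
    have _ : BorelSpace X := ⟨rfl⟩
    exact MeasurableSet.biInter hBcount fun U hU =>
      (hφ _ (hinter A U hA)).1.union (hBbasis.isOpen hU).measurableSet.compl
  · refine Set.subset_iInter₂ fun U _ x hx => ?_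
    by_cases hxU : x ∈ U
    · exact Or.inl ((hφ _ (hinter A U hA)).2.1 ⟨hx, hxU⟩)
    · exact Or.inr hxU
  · refine (hφ A hA).2.2.mono (Set.sdiff_subset_sdiff_left fun x hx => ?_)
    simpa using Set.mem_iInter₂.1 hx Set.univ hBuniv
  · intro A A' hA hA' hAA'
    exact Set.iInter₂_mono fun U _ => Set.union_subset_union_left _ <|
      hmono _ _ (hinter A U hA) (hinter A' U hA') (Set.inter_subset_inter_left U hAA')
  · rintro A hA U hU x ⟨hx, hxU⟩
    refine Set.mem_iInter₂.2 fun V hV => ?_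
    by_cases hxV : x ∈ V
    · left
      rw [Set.inter_assoc]
      exact (Set.mem_iInter₂.1 hx (U ∩ V) (hBinter U hU V hV)).resolve_right
        fun hnot => hnot ⟨hxU, hxV⟩
    · exact Or.inr hxV
end

section
/- Let X be a Polish space and let ℬ be a countable base of open sets of X that is closed under finite intersections and contains X. If there exists a ℬ-regular monotone Borel hull operation on ℳ with respect to ℳ, then there exists a monotone Borel hull operation on the σ-algebra Baire of subsets of X with the Baire property, with respect to ℳ. -/
open MeasureTheory

/-- A set has the Baire property if it differs from some open set by a meager set. -/
def HasBaireProp {X : Type*} [TopologicalSpace X] (A : Set X) : Prop :=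
  ∃ U : Set X, IsOpen U ∧ IsMeagre ((A \ U) ∪ (U \ A))

/-- The closure of the union of the members of `B` in which `Z` is comeager. -/
def comeagerClosure {X : Type*} [TopologicalSpace X] (B : Set (Set X)) (Z : Set X) : Set X :=
  closure (⋃₀ {V | V ∈ B ∧ IsMeagre (V \ Z)})

theorem comeagerClosure_mono {X : Type*} [TopologicalSpace X] (B : Set (Set X)) {Z Y : Set X}
    (h : Z ⊆ Y) : comeagerClosure B Z ⊆ comeagerClosure B Y :=
  closure_mono <| Set.sUnion_subset_sUnion fun _ hV =>
    ⟨hV.1, hV.2.mono (Set.sdiff_subset_sdiff_right h)⟩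

theorem isMeagre_comeagerClosure_diff {X : Type*} [TopologicalSpace X] {B : Set (Set X)}
    (hBcount : B.Countable) (hBopen : ∀ V ∈ B, IsOpen V) (Z : Set X) :
    IsMeagre (comeagerClosure B Z \ Z) := by
  set S : Set (Set X) := {V | V ∈ B ∧ IsMeagre (V \ Z)}
  have hSopen : IsOpen (⋃₀ S) := isOpen_sUnion fun V hV => hBopen V hV.1
  have hfront : IsMeagre (frontier (⋃₀ S)) := by
    refine (isClosed_frontier.isNowhereDense_iff.2 ?_).isMeagre
    rw [← frontier_compl, interior_frontier hSopen.isClosed_compl]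
  have hS : IsMeagre (⋃ V ∈ S, V \ Z) :=
    isMeagre_biUnion (hBcount.mono fun _ hV => hV.1) fun V hV => hV.2
  refine (hfront.union hS).mono ?_
  rintro x ⟨hx, hxZ⟩
  by_cases hxS : x ∈ ⋃₀ S
  · obtain ⟨V, hV, hxV⟩ := hxS
    exact Or.inr (Set.mem_biUnion hV ⟨hxV, hxZ⟩)
  · exact Or.inl (by rw [hSopen.frontier_eq]; exact ⟨hx, hxS⟩)

theorem HasBaireProp.isMeagre_diff_comeagerClosure {X : Type*} [TopologicalSpace X]
    {B : Set (Set X)} (hB : TopologicalSpace.IsTopologicalBasis B) {Z : Set X}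
    (hZ : HasBaireProp Z) : IsMeagre (Z \ comeagerClosure B Z) := by
  obtain ⟨W, hW, hWZ⟩ := hZ
  refine hWZ.mono fun x hx => Or.inl ⟨hx.1, fun hxW => hx.2 (subset_closure ?_)⟩
  obtain ⟨V, hV, hxV, hVW⟩ := hB.exists_subset_of_mem_open hxW hW
  exact ⟨V, ⟨hV, hWZ.mono fun y hy => Or.inr ⟨hVW hy.1, hy.2⟩⟩, hxV⟩

/-- If there is a `B`-regular monotone Borel hull operation on the meager ideal of a
Polish space `X` (where `B` is a countable base closed under finite intersections with
`X ∈ B`), then there is a monotone Borel hull operation, with respect to the meager ideal,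
on the σ-algebra of sets with the Baire property. -/
theorem exists_monotone_hull_on_baire_of_regular_hull {X : Type*} [TopologicalSpace X]
    [PolishSpace X] (B : Set (Set X)) (hBcount : B.Countable)
    (hBbasis : TopologicalSpace.IsTopologicalBasis B)
    (hBinter : ∀ U ∈ B, ∀ V ∈ B, U ∩ V ∈ B) (hBuniv : Set.univ ∈ B)
    (h : ∃ φ : Set X → Set X,
      (∀ A : Set X, IsMeagre A →
        MeasurableSet[borel X] (φ A) ∧ A ⊆ φ A ∧ IsMeagre (φ A \ A)) ∧
      (∀ A A' : Set X, IsMeagre A → IsMeagre A' → A ⊆ A' → φ A ⊆ φ A') ∧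
      (∀ A : Set X, IsMeagre A → ∀ U ∈ B, φ A ∩ U ⊆ φ (A ∩ U))) :
    ∃ ψ : Set X → Set X,
      (∀ Z : Set X, HasBaireProp Z →
        MeasurableSet[borel X] (ψ Z) ∧ Z ⊆ ψ Z ∧ IsMeagre (ψ Z \ Z)) ∧
      (∀ Z Y : Set X, HasBaireProp Z → HasBaireProp Y → Z ⊆ Y → ψ Z ⊆ ψ Y) := by
  obtain ⟨φ, hφ, hmono, hreg⟩ := h
  refine ⟨fun Z => comeagerClosure B Z ∪ φ (Z \ comeagerClosure B Z), fun Z hZ => ?_,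
    fun Z Y hZ hY hZY => ?_⟩
  · obtain ⟨hmeas, hsub, hdiff⟩ := hφ _ (hZ.isMeagre_diff_comeagerClosure hBbasis)
    refine ⟨?_, fun x hx => ?_, ?_⟩
    · borelize X
      exact isClosed_closure.measurableSet.union hmeas
    · by_cases hxC : x ∈ comeagerClosure B Z
      · exact Or.inl hxC
      · exact Or.inr (hsub ⟨hx, hxC⟩)
    · refine ((isMeagre_comeagerClosure_diff hBcount (fun V => hBbasis.isOpen) Z).union
        hdiff).mono ?_
      rintro x ⟨hx | hx, hxZ⟩
      · exact Or.inl ⟨hx, hxZ⟩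
      · exact Or.inr ⟨hx, fun hxA => hxZ hxA.1⟩
  · rintro x (hx | hx)
    · exact Or.inl (comeagerClosure_mono B hZY hx)
    · by_cases hxC : x ∈ comeagerClosure B Y
      · exact Or.inl hxC
      obtain ⟨U, hU, hxU, hUC⟩ := hBbasis.exists_subset_of_mem_open
        (show x ∈ (comeagerClosure B Y)ᶜ from hxC) isClosed_closure.isOpen_compl
      have hA := hZ.isMeagre_diff_comeagerClosure hBbasis
      exact Or.inr <| hmono _ _ (hA.mono Set.inter_subset_left)
        (hY.isMeagre_diff_comeagerClosure hBbasis) (fun y hy => ⟨hZY hy.1.1, hUC hy.2⟩)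
        (hreg _ hA U hU ⟨hx, hxU⟩)
end

section
/- Let X be a Polish space. There exists a monotone Borel hull operation on ℳ with respect to ℳ if and only if there exists a monotone Borel hull operation on the σ-algebra Baire of subsets of X with the Baire property, with respect to ℳ. -/
open MeasureTheory

/-- The frontier of an open set is meagre. -/
lemma IsOpen.isMeagre_frontier {X : Type*} [TopologicalSpace X] {U : Set X} (hU : IsOpen U) :
    IsMeagre (frontier U) := by
  refine IsNowhereDense.isMeagre ?_
  rw [isClosed_frontier.isNowhereDense_iff, ← frontier_compl]
  exact interior_frontier hU.isClosed_compl

/-- A meagre set has the Baire property. -/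
lemma IsMeagre.hasBaireProp {X : Type*} [TopologicalSpace X] {A : Set X} (hA : IsMeagre A) :
    HasBaireProp A :=
  ⟨∅, isOpen_empty, by simpa using hA⟩

/-- The extension of a hull operation `φ` on meagre sets to arbitrary sets: a point is left out
of the hull of `Z` when some `V ∈ b` contains it, meets `Z` in a meagre set, and `φ (Z ∩ V)`
leaves it out. -/
def localHull {X : Type*} [TopologicalSpace X] (b : Set (Set X)) (φ : Set X → Set X)
    (Z : Set X) : Set X :=
  (⋃ V ∈ {V ∈ b | IsMeagre (Z ∩ V)}, V \ φ (Z ∩ V))ᶜ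

section localHull

variable {X : Type*} [TopologicalSpace X] {b : Set (Set X)} {φ : Set X → Set X}

lemma measurableSet_localHull (hb : b.Countable) (hbo : ∀ V ∈ b, IsOpen V)
    (hφ : ∀ A, IsMeagre A → MeasurableSet[borel X] (φ A)) (Z : Set X) :
    MeasurableSet[borel X] (localHull b φ Z) := by
  borelize X
  refine (MeasurableSet.biUnion (hb.mono (Set.sep_subset _ _)) ?_).compl
  rintro V ⟨hV, hZV⟩
  exact (hbo V hV).measurableSet.diff (hφ _ hZV)

lemma subset_localHull (hφ : ∀ A, IsMeagre A → A ⊆ φ A) (Z : Set X) :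
    Z ⊆ localHull b φ Z := by
  intro x hx hmem
  simp only [Set.mem_iUnion] at hmem
  obtain ⟨V, ⟨_, hZV⟩, hxV, hxφ⟩ := hmem
  exact hxφ (hφ _ hZV ⟨hx, hxV⟩)

lemma localHull_mono (hφ : ∀ A B, IsMeagre A → IsMeagre B → A ⊆ B → φ A ⊆ φ B) {Z Y : Set X}
    (h : Z ⊆ Y) : localHull b φ Z ⊆ localHull b φ Y := by
  refine Set.compl_subset_compl.mpr fun x hx => ?_
  simp only [Set.mem_iUnion] at hx ⊢
  obtain ⟨V, ⟨hV, hYV⟩, hxV, hxφ⟩ := hx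
  have hsub : Z ∩ V ⊆ Y ∩ V := Set.inter_subset_inter_left V h
  have hZV := hYV.mono hsub
  exact ⟨V, ⟨hV, hZV⟩, hxV, fun hx' => hxφ (hφ _ _ hZV hYV hsub hx')⟩

lemma isMeagre_localHull_diff (hb : b.Countable) (hbasis : TopologicalSpace.IsTopologicalBasis b)
    (hφ : ∀ A, IsMeagre A → IsMeagre (φ A \ A)) {Z : Set X} (hZ : HasBaireProp Z) :
    IsMeagre (localHull b φ Z \ Z) := by
  obtain ⟨U, hU, hZU⟩ := hZ
  have hlocal : IsMeagre (⋃ V ∈ {V ∈ b | IsMeagre (Z ∩ V)}, φ (Z ∩ V) \ (Z ∩ V)) :=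
    isMeagre_biUnion (hb.mono (Set.sep_subset _ _)) fun V hV => hφ _ hV.2
  refine ((hlocal.union hU.isMeagre_frontier).union hZU).mono ?_
  rintro x ⟨hx, hxZ⟩
  by_cases hxU : x ∈ closure U
  · by_cases hxU' : x ∈ U
    · exact Or.inr (Or.inr ⟨hxU', hxZ⟩)
    · exact Or.inl (Or.inr ⟨hxU, fun h => hxU' (interior_subset h)⟩)
  · obtain ⟨V, hV, hxV, hVU⟩ :=
      hbasis.exists_subset_of_mem_open (Set.mem_compl hxU) isClosed_closure.isOpen_compl
    have hZV : IsMeagre (Z ∩ V) :=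
      hZU.mono fun y hy => Or.inl ⟨hy.1, fun hyU => hVU hy.2 (subset_closure hyU)⟩
    have hxφ : x ∈ φ (Z ∩ V) := by
      by_contra hxφ
      exact hx (Set.mem_biUnion (x := V) ⟨hV, hZV⟩ ⟨hxV, hxφ⟩)
    exact Or.inl (Or.inl (Set.mem_biUnion (x := V) ⟨hV, hZV⟩ ⟨hxφ, fun h => hxZ h.1⟩))

end localHull

/-- For a Polish space `X`, there is a monotone Borel hull operation on the meager ideal
(with respect to the meager ideal) if and only if there is a monotone Borel hull operation
on the σ-algebra of sets with the Baire property (with respect to the meager ideal). -/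
theorem monotone_hull_on_meager_iff_on_baire {X : Type*} [TopologicalSpace X]
    [PolishSpace X] :
    (∃ φ : Set X → Set X,
      (∀ A : Set X, IsMeagre A →
        MeasurableSet[borel X] (φ A) ∧ A ⊆ φ A ∧ IsMeagre (φ A \ A)) ∧
      (∀ A A' : Set X, IsMeagre A → IsMeagre A' → A ⊆ A' → φ A ⊆ φ A')) ↔
    (∃ ψ : Set X → Set X,
      (∀ Z : Set X, HasBaireProp Z →
        MeasurableSet[borel X] (ψ Z) ∧ Z ⊆ ψ Z ∧ IsMeagre (ψ Z \ Z)) ∧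
      (∀ Z Y : Set X, HasBaireProp Z → HasBaireProp Y → Z ⊆ Y → ψ Z ⊆ ψ Y)) := by
  constructor
  · rintro ⟨φ, hφ, hmono⟩
    have hbasis := TopologicalSpace.isBasis_countableBasis X
    have hb := TopologicalSpace.countable_countableBasis X
    refine ⟨localHull (TopologicalSpace.countableBasis X) φ, fun Z hZ => ⟨?_, ?_, ?_⟩,
      fun Z Y _ _ h => localHull_mono hmono h⟩
    · exact measurableSet_localHull hb (fun V hV => hbasis.isOpen hV) (fun A hA => (hφ A hA).1) Z
    · exact subset_localHull (fun A hA => (hφ A hA).2.1) Z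
    · exact isMeagre_localHull_diff hb hbasis (fun A hA => (hφ A hA).2.2) hZ
  · rintro ⟨ψ, hψ, hmono⟩
    exact ⟨ψ, fun A hA => hψ A hA.hasBaireProp,
      fun A A' hA hA' => hmono A A' hA.hasBaireProp hA'.hasBaireProp⟩
end
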